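/- arXiv:1603.01379 — 2 statements merged into one kernel-verified Lean document; each statement's English description precedes it below -/
import Mathlib

section
/- Let n ≥ 1, p ≥ 2, ν ∈ S^{2n}, d ∈ ℝ, and Π⁺_{ν,d} = {ξ ∈ ℝ^{2n+1} : ⟨ξ, ν⟩ > d}. Then for every u ∈ C_0^∞(Π⁺_{ν,d}) one has ∫_{Π⁺_{ν,d}} |∇_{ℍⁿ} u|^p dξ ≥ ((p−1)/p)^p ∫_{Π⁺_{ν,d}} Σ_{i=1}^n (|⟨X_i(ξ), ν⟩|^p + |⟨Y_i(ξ), ν⟩|^p) / dist(ξ, ∂Π⁺_{ν,d})^p · |u|^p dξ, where dist(ξ, ∂Π⁺_{ν,d}) = ⟨ξ, ν⟩ − d. -/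
open MeasureTheory RealInnerProductSpace

noncomputable section

/-- The Heisenberg group `ℍⁿ`, identified with Euclidean `ℝ^{2n+1}`;
coordinates `0,…,n-1` are `x`, `n,…,2n-1` are `y`, and `2n` is `t`. -/
abbrev Heis (n : ℕ) := EuclideanSpace ℝ (Fin (2 * n + 1))

/-- Index of the coordinate `x_i`. -/
def xIdx {n : ℕ} (i : Fin n) : Fin (2 * n + 1) := ⟨i.1, by have := i.2; omega⟩

/-- Index of the coordinate `y_i`. -/
def yIdx {n : ℕ} (i : Fin n) : Fin (2 * n + 1) := ⟨n + i.1, by have := i.2; omega⟩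

/-- Index of the coordinate `t`. -/
def tIdx (n : ℕ) : Fin (2 * n + 1) := ⟨2 * n, by omega⟩

/-- The horizontal vector field `X_i = ∂/∂x_i + 2 y_i ∂/∂t` acting on a function. -/
def Xd {n : ℕ} (i : Fin n) (u : Heis n → ℝ) (ξ : Heis n) : ℝ :=
  fderiv ℝ u ξ (EuclideanSpace.single (xIdx i) 1)
    + 2 * ξ (yIdx i) * fderiv ℝ u ξ (EuclideanSpace.single (tIdx n) 1)

/-- The horizontal vector field `Y_i = ∂/∂y_i − 2 x_i ∂/∂t` acting on a function. -/
def Yd {n : ℕ} (i : Fin n) (u : Heis n → ℝ) (ξ : Heis n) : ℝ :=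
  fderiv ℝ u ξ (EuclideanSpace.single (yIdx i) 1)
    - 2 * ξ (xIdx i) * fderiv ℝ u ξ (EuclideanSpace.single (tIdx n) 1)

/-- `|∇_{ℍⁿ} u|² = Σ_i (X_i u)² + (Y_i u)²`. -/
def gradH2 {n : ℕ} (u : Heis n → ℝ) (ξ : Heis n) : ℝ :=
  ∑ i : Fin n, ((Xd i u ξ) ^ 2 + (Yd i u ξ) ^ 2)

/-- `⟨X_i(ξ), ν⟩ = ν_{x_i} + 2 y_i ν_t`. -/
def XiNu {n : ℕ} (i : Fin n) (ξ ν : Heis n) : ℝ := ν (xIdx i) + 2 * ξ (yIdx i) * ν (tIdx n)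

/-- `⟨Y_i(ξ), ν⟩ = ν_{y_i} − 2 x_i ν_t`. -/
def YiNu {n : ℕ} (i : Fin n) (ξ ν : Heis n) : ℝ := ν (yIdx i) - 2 * ξ (xIdx i) * ν (tIdx n)

/-- The pointwise Young inequality behind the `L^p` Hardy inequality: `z` is the derivative of `u`
along the field, `c` that of the distance `δ`. -/
theorem hardy_pointwise {p : ℝ} (hp : 2 ≤ p) {δ : ℝ} (hδ : 0 < δ) (c v z : ℝ) :
    ((p - 1) / p) ^ p * (|c| ^ p / δ ^ p * |v| ^ p)
      + ((p - 1) / p) ^ (p - 1) * (|c| ^ (p - 2) * c *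
        ((1 - p) * δ ^ (-p) * c * |v| ^ p + δ ^ (1 - p) * (p * |v| ^ (p - 2) * v * z)))
      ≤ |z| ^ p := by
  have hp0 : 0 < p := by linarith
  have hk : 0 < (p - 1) / p := div_pos (by linarith) hp0
  set k := (p - 1) / p with hkdef
  have hkp : k * p = p - 1 := by rw [hkdef]; field_simp
  set A := |c| * |v| / δ with hA
  have hA0 : 0 ≤ A := by positivity
  have hAp : A ^ p = |c| ^ p / δ ^ p * |v| ^ p := by
    rw [hA, Real.div_rpow (by positivity) hδ.le, Real.mul_rpow (by positivity) (by positivity)]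
    ring
  have hAp1 : A ^ (p - 1) = |c| ^ (p - 1) * |v| ^ (p - 1) * δ ^ (1 - p) := by
    rw [hA, Real.div_rpow (by positivity) hδ.le, Real.mul_rpow (by positivity) (by positivity),
      show 1 - p = -(p - 1) by ring, Real.rpow_neg hδ.le]
    ring
  have hsplit : ∀ a : ℝ, |a| ^ (p - 2) * |a| = |a| ^ (p - 1) := fun a => by
    rw [← Real.rpow_add_one' (abs_nonneg a) (by linarith)]; ring_nf
  have hsq : ∀ a : ℝ, |a| ^ (p - 2) * a * a = |a| ^ p := fun a => by
    rw [mul_assoc, ← abs_mul_abs_self a, ← mul_assoc, hsplit,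
      ← Real.rpow_add_one' (abs_nonneg a) (by linarith)]
    ring_nf
  have hkk : k ^ p = k ^ (p - 1) * k := by
    rw [← Real.rpow_add_one' hk.le (by linarith)]; ring_nf
  have hcross : |c| ^ (p - 2) * c * (δ ^ (1 - p) * (|v| ^ (p - 2) * v * z))
      ≤ A ^ (p - 1) * |z| := by
    refine (le_abs_self _).trans (le_of_eq ?_)
    have hd : 0 ≤ δ ^ (1 - p) := by positivity
    simp only [abs_mul, abs_of_nonneg hd, abs_of_nonneg (Real.rpow_nonneg (abs_nonneg c) _),
      abs_of_nonneg (Real.rpow_nonneg (abs_nonneg v) _)]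
    rw [hAp1, ← hsplit c, ← hsplit v]
    ring
  have hconj : (p / (p - 1)).HolderConjugate p :=
    (Real.HolderConjugate.conjExponent (by linarith)).symm
  have hyoung := Real.young_inequality_of_nonneg
    (Real.rpow_nonneg (mul_nonneg hk.le hA0) (p - 1)) (abs_nonneg z) hconj
  rw [← Real.rpow_mul (mul_nonneg hk.le hA0),
    mul_div_cancel₀ _ (by linarith : p - 1 ≠ 0), Real.mul_rpow hk.le hA0,
    Real.mul_rpow hk.le hA0] at hyoung
  have hyoung' : p * (k ^ (p - 1) * (A ^ (p - 1) * |z|)) ≤ (p - 1) * (k ^ p * A ^ p) + |z| ^ p := by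
    have := mul_le_mul_of_nonneg_left hyoung hp0.le
    have h1 : p * (k ^ p * A ^ p / (p / (p - 1)) + |z| ^ p / p)
        = (p - 1) * (k ^ p * A ^ p) + |z| ^ p := by
      have : p - 1 ≠ 0 := by linarith
      field_simp
    rw [h1] at this
    linarith
  have hc' := mul_le_mul_of_nonneg_left hcross
    (mul_nonneg hp0.le (Real.rpow_nonneg hk.le (p - 1)))
  have hAp' : |c| ^ (p - 2) * c * c * δ ^ (-p) * |v| ^ p = A ^ p := by
    rw [hsq, hAp, Real.rpow_neg hδ.le]; ring
  have hid : k ^ (p - 1) * (|c| ^ (p - 2) * c *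
        ((1 - p) * δ ^ (-p) * c * |v| ^ p + δ ^ (1 - p) * (p * |v| ^ (p - 2) * v * z)))
      = p * k ^ (p - 1) * (|c| ^ (p - 2) * c * (δ ^ (1 - p) * (|v| ^ (p - 2) * v * z)))
        - k ^ (p - 1) * (p - 1) * A ^ p := by
    rw [← hAp']; ring
  have hconst : k ^ (p - 1) * (p - 1) * A ^ p = p * (k ^ p * A ^ p) := by
    rw [hkk, ← hkp]; ring
  rw [hid, hconst, ← hAp]
  linarith

section HalfSpace

variable {E : Type*} [NormedAddCommGroup E] [InnerProductSpace ℝ E]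

/-- A real power of the distance to the boundary of a half-space, times a power of a function
supported in the half-space, is `C¹` on the whole space. -/
theorem contDiff_dist_rpow_mul_abs_rpow {p : ℝ} (hp : 1 < p) (r : ℝ) {ν : E} {d : ℝ} {u : E → ℝ}
    (hu : ContDiff ℝ 1 u) (hsupp : tsupport u ⊆ {ξ : E | d < ⟪ξ, ν⟫}) :
    ContDiff ℝ 1 (fun ξ => (⟪ξ, ν⟫ - d) ^ r * |u ξ| ^ p) := by
  rw [contDiff_iff_contDiffAt]
  intro ξ
  by_cases hξ : ξ ∈ tsupport u
  · have hδ : 0 < ⟪ξ, ν⟫ - d := sub_pos.2 (hsupp hξ)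
    refine ContDiffAt.mul ?_ (hu.norm_rpow hp).contDiffAt
    exact ((contDiffAt_id.inner ℝ contDiffAt_const).sub contDiffAt_const).rpow_const_of_ne hδ.ne'
  · refine (contDiffAt_const (c := (0 : ℝ))).congr_of_eventuallyEq ?_
    filter_upwards [notMem_tsupport_iff_eventuallyEq.1 hξ] with η hη
    simp [hη, Real.zero_rpow (by linarith : p ≠ 0)]

theorem fderiv_dist_rpow_mul_abs_rpow {p : ℝ} (hp : 1 < p) {ν : E} {d : ℝ} {u : E → ℝ}
    (hu : ContDiff ℝ 1 u) {ξ : E} (hξ : d < ⟪ξ, ν⟫) (w : E) :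
    fderiv ℝ (fun ξ => (⟪ξ, ν⟫ - d) ^ (1 - p) * |u ξ| ^ p) ξ w =
      (1 - p) * (⟪ξ, ν⟫ - d) ^ (-p) * ⟪w, ν⟫ * |u ξ| ^ p
        + (⟪ξ, ν⟫ - d) ^ (1 - p) * (p * |u ξ| ^ (p - 2) * u ξ * fderiv ℝ u ξ w) := by
  have hδ : 0 < ⟪ξ, ν⟫ - d := sub_pos.2 hξ
  have h1 : HasFDerivAt (fun ξ : E => ⟪ξ, ν⟫ - d) (innerSL ℝ ν) ξ := by
    have h := ((innerSL ℝ ν).hasFDerivAt (x := ξ)).sub_const d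
    refine h.congr_of_eventuallyEq (.of_forall fun η => ?_)
    simp [real_inner_comm]
  have h2 := h1.rpow_const (p := 1 - p) (Or.inl hδ.ne')
  have h3 := (hasDerivAt_abs_rpow (u ξ) hp).comp_hasFDerivAt ξ
    ((hu.differentiable one_ne_zero) ξ).hasFDerivAt
  have h4 : HasFDerivAt (fun ξ => (⟪ξ, ν⟫ - d) ^ (1 - p) * |u ξ| ^ p) _ ξ := h2.mul h3
  rw [h4.fderiv]
  simp only [add_apply, smul_apply, innerSL_apply_apply,
    smul_eq_mul, real_inner_comm ν w]
  rw [show 1 - p - 1 = -p by ring]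
  ring

variable [FiniteDimensional ℝ E] [MeasurableSpace E] [BorelSpace E]

/-- The derivative of a compactly supported function in a direction along which the weight is
constant has zero weighted integral. -/
theorem integral_mul_fderiv_eq_zero {G h : E → ℝ} {w : E} (hG : Continuous G)
    (hGw : ∀ ξ (s : ℝ), G (ξ + s • w) = G ξ) (hh : ContDiff ℝ 1 h) (hc : HasCompactSupport h) :
    ∫ ξ, G ξ * fderiv ℝ h ξ w = 0 := by
  have hcd : HasCompactSupport fun ξ => fderiv ℝ h ξ w :=
    hc.fderiv_apply (𝕜 := ℝ) w
  have hd : Continuous fun ξ => fderiv ℝ h ξ w :=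
    (hh.continuous_fderiv one_ne_zero).clm_apply continuous_const
  have := integral_bilinear_hasLineDerivAt_right_eq_neg_left_of_integrable
    (μ := (volume : Measure E)) (f := G) (f' := fun _ => (0 : ℝ)) (g := h)
    (g' := fun ξ => fderiv ℝ h ξ w) (v := w) (B := ContinuousLinearMap.mul ℝ ℝ)
    (by simp) ((hG.mul hd).integrable_of_hasCompactSupport hcd.mul_left)
    ((hG.mul hh.continuous).integrable_of_hasCompactSupport hc.mul_left)
    (fun ξ _ => by
      simpa [HasLineDerivAt, hGw] using hasDerivAt_const (0 : ℝ) (G ξ))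
    (fun ξ _ => ((hh.differentiable one_ne_zero) ξ).hasFDerivAt.hasLineDerivAt w)
  simpa using this

/-- Integrability of the gradient term for a single field `e + b f`. -/
theorem integrable_abs_fderiv_rpow {p : ℝ} (hp : 0 < p) {u : E → ℝ} (hu : ContDiff ℝ 1 u)
    (hc : HasCompactSupport u) (e f : E) {b : E → ℝ} (hb : Continuous b) :
    Integrable fun ξ => |fderiv ℝ u ξ e + b ξ * fderiv ℝ u ξ f| ^ p := by
  have hd : ∀ w, Continuous fun ξ => fderiv ℝ u ξ w := fun w =>
    (hu.continuous_fderiv one_ne_zero).clm_apply continuous_const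
  refine Continuous.integrable_of_hasCompactSupport
    (((hd e).add (hb.mul (hd f))).abs.rpow_const fun _ => Or.inr hp.le) ?_
  refine ((hc.fderiv (𝕜 := ℝ)).mono ?_)
  intro ξ hξ hz
  exact hξ (by simp [hz, Real.zero_rpow hp.ne'])

/-- Integrability of the weighted term for a single field with normal component `c`. -/
theorem integrableOn_hardy_weight {p : ℝ} (hp : 1 < p) {ν : E} {d : ℝ} {u : E → ℝ}
    (hu : ContDiff ℝ 1 u) (hc : HasCompactSupport u) (hsupp : tsupport u ⊆ {ξ : E | d < ⟪ξ, ν⟫})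
    {c : E → ℝ} (hcc : Continuous c) :
    IntegrableOn (fun ξ => |c ξ| ^ p / (⟪ξ, ν⟫ - d) ^ p * |u ξ| ^ p) {ξ : E | d < ⟪ξ, ν⟫} := by
  have hU : MeasurableSet {ξ : E | d < ⟪ξ, ν⟫} :=
    (isOpen_lt continuous_const (by fun_prop)).measurableSet
  have hcs : HasCompactSupport fun ξ => (⟪ξ, ν⟫ - d) ^ (-p) * |u ξ| ^ p :=
    hc.mono fun ξ hξ hz => hξ (by simp [hz, Real.zero_rpow (by linarith : p ≠ 0)])
  have hint : Integrable fun ξ => |c ξ| ^ p * ((⟪ξ, ν⟫ - d) ^ (-p) * |u ξ| ^ p) := ((hcc.abs.rpow_const fun _ => Or.inr (by linarith : 0 ≤ p)).mul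
    (contDiff_dist_rpow_mul_abs_rpow hp (-p) hu hsupp).continuous).integrable_of_hasCompactSupport
    (μ := volume) hcs.mul_left
  refine hint.integrableOn.congr_fun (fun ξ hξ => ?_) hU
  have hδ : 0 < ⟪ξ, ν⟫ - d := sub_pos.2 hξ
  simp only [Real.rpow_neg hδ.le]
  ring

/-- The Hardy inequality on a half-space along a single field `e + b f` whose coefficient `b` is
constant in the directions `e` and `f`. -/
theorem hardy_halfspace_field {p : ℝ} (hp : 2 ≤ p) {ν : E} {d : ℝ} {u : E → ℝ}
    (hu : ContDiff ℝ 1 u) (hc : HasCompactSupport u) (hsupp : tsupport u ⊆ {ξ : E | d < ⟪ξ, ν⟫})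
    (e f : E) {b : E → ℝ} (hb : Continuous b) (hbe : ∀ ξ (s : ℝ), b (ξ + s • e) = b ξ)
    (hbf : ∀ ξ (s : ℝ), b (ξ + s • f) = b ξ) :
    ((p - 1) / p) ^ p * ∫ ξ in {ξ : E | d < ⟪ξ, ν⟫},
        |⟪e, ν⟫ + b ξ * ⟪f, ν⟫| ^ p / (⟪ξ, ν⟫ - d) ^ p * |u ξ| ^ p
      ≤ ∫ ξ in {ξ : E | d < ⟪ξ, ν⟫}, |fderiv ℝ u ξ e + b ξ * fderiv ℝ u ξ f| ^ p := by
  set U := {ξ : E | d < ⟪ξ, ν⟫} with hUdef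
  have hU : MeasurableSet U := (isOpen_lt continuous_const (by fun_prop)).measurableSet
  have hp1 : 1 < p := by linarith
  set c : E → ℝ := fun ξ => ⟪e, ν⟫ + b ξ * ⟪f, ν⟫ with hcdef
  have hcc : Continuous c := by fun_prop
  set h : E → ℝ := fun ξ => (⟪ξ, ν⟫ - d) ^ (1 - p) * |u ξ| ^ p with hh
  have hhC : ContDiff ℝ 1 h := contDiff_dist_rpow_mul_abs_rpow hp1 (1 - p) hu hsupp
  have hsub : Function.support h ⊆ Function.support u :=
    fun ξ hξ hz => hξ (by simp [hh, hz, Real.zero_rpow (by linarith : p ≠ 0)])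
  have hhc : HasCompactSupport h := hc.mono hsub
  have hhd : ∀ w, Continuous fun ξ => fderiv ℝ h ξ w := fun w =>
    (hhC.continuous_fderiv one_ne_zero).clm_apply continuous_const
  have hφ : Continuous fun ξ => |c ξ| ^ (p - 2) * c ξ :=
    (hcc.abs.rpow_const fun _ => Or.inr (by linarith)).mul hcc
  have hφb : Continuous fun ξ => |c ξ| ^ (p - 2) * c ξ * b ξ := hφ.mul hb
  have hie : Integrable fun ξ => |c ξ| ^ (p - 2) * c ξ * fderiv ℝ h ξ e :=
    (hφ.mul (hhd e)).integrable_of_hasCompactSupport (hhc.fderiv_apply (𝕜 := ℝ) e).mul_left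
  have hif : Integrable fun ξ => |c ξ| ^ (p - 2) * c ξ * b ξ * fderiv ℝ h ξ f :=
    (hφb.mul (hhd f)).integrable_of_hasCompactSupport
      (hhc.fderiv_apply (𝕜 := ℝ) f).mul_left
  have h0 : ∫ ξ in U, (|c ξ| ^ (p - 2) * c ξ * fderiv ℝ h ξ e
      + |c ξ| ^ (p - 2) * c ξ * b ξ * fderiv ℝ h ξ f) = 0 := by
    rw [setIntegral_eq_integral_of_forall_compl_eq_zero, integral_add hie hif,
      integral_mul_fderiv_eq_zero hφ (fun ξ s => by simp [hcdef, hbe]) hhC hhc,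
      integral_mul_fderiv_eq_zero hφb (fun ξ s => by simp only [hcdef, hbf]) hhC hhc, add_zero]
    intro ξ hξ
    have hz : fderiv ℝ h ξ = 0 := by
      by_contra hne
      exact hξ (hsupp (closure_mono hsub (support_fderiv_subset ℝ hne)))
    simp [hz]
  have hL := integrableOn_hardy_weight hp1 hu hc hsupp hcc
  have hR := (integrable_abs_fderiv_rpow (by linarith : 0 < p) hu hc e f hb).integrableOn (s := U)
  have hD : IntegrableOn (fun ξ => |c ξ| ^ (p - 2) * c ξ * fderiv ℝ h ξ e
      + |c ξ| ^ (p - 2) * c ξ * b ξ * fderiv ℝ h ξ f) U := (hie.add hif).integrableOn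
  calc ((p - 1) / p) ^ p * ∫ ξ in U, |c ξ| ^ p / (⟪ξ, ν⟫ - d) ^ p * |u ξ| ^ p
      = ∫ ξ in U, (((p - 1) / p) ^ p * (|c ξ| ^ p / (⟪ξ, ν⟫ - d) ^ p * |u ξ| ^ p)
        + ((p - 1) / p) ^ (p - 1) * (|c ξ| ^ (p - 2) * c ξ * fderiv ℝ h ξ e
          + |c ξ| ^ (p - 2) * c ξ * b ξ * fderiv ℝ h ξ f)) := by
        rw [integral_add (hL.const_mul _) (hD.const_mul _), integral_const_mul,
          integral_const_mul, h0, mul_zero, add_zero]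
    _ ≤ _ := by
        refine setIntegral_mono_on ((hL.const_mul _).add (hD.const_mul _)) hR hU fun ξ hξ => ?_
        refine le_of_eq_of_le ?_ (hardy_pointwise hp (sub_pos.2 hξ) (c ξ) (u ξ) _)
        rw [hh, fderiv_dist_rpow_mul_abs_rpow hp1 hu hξ, fderiv_dist_rpow_mul_abs_rpow hp1 hu hξ]
        simp only [hcdef]
        ring

end HalfSpace

/-- For `p ≥ 2` the `ℓ^p` norm is at most the `ℓ²` norm. -/
theorem sum_abs_rpow_le_sqrt_sum_sq_rpow {ι : Type*} (s : Finset ι) {p : ℝ} (hp : 2 ≤ p)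
    (a b : ι → ℝ) :
    ∑ i ∈ s, (|a i| ^ p + |b i| ^ p) ≤ Real.sqrt (∑ i ∈ s, (a i ^ 2 + b i ^ 2)) ^ p := by
  set S := ∑ i ∈ s, (a i ^ 2 + b i ^ 2) with hS
  have hsplit : ∀ x : ℝ, 0 ≤ x → x ^ p = x ^ 2 * x ^ (p - 2) := fun x hx => by
    rw [← Real.rpow_two, ← Real.rpow_add' hx (by linarith)]; ring_nf
  have hS0 : 0 ≤ S := Finset.sum_nonneg fun i _ => by positivity
  have key : ∀ x : ℝ, x ^ 2 ≤ S → |x| ^ p ≤ x ^ 2 * Real.sqrt S ^ (p - 2) := fun x hx => by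
    rw [hsplit _ (abs_nonneg x), sq_abs]
    exact mul_le_mul_of_nonneg_left
      (Real.rpow_le_rpow (abs_nonneg x) (Real.abs_le_sqrt hx) (by linarith)) (sq_nonneg x)
  have hle : ∀ i ∈ s, a i ^ 2 + b i ^ 2 ≤ S := fun i hi =>
    Finset.single_le_sum (f := fun i => a i ^ 2 + b i ^ 2) (fun i _ => by positivity) hi
  calc ∑ i ∈ s, (|a i| ^ p + |b i| ^ p)
      ≤ ∑ i ∈ s, (a i ^ 2 + b i ^ 2) * Real.sqrt S ^ (p - 2) := by
        refine Finset.sum_le_sum fun i hi => ?_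
        rw [add_mul]
        exact add_le_add (key _ (by nlinarith [hle i hi, sq_nonneg (b i)]))
          (key _ (by nlinarith [hle i hi, sq_nonneg (a i)]))
    _ = Real.sqrt S ^ p := by
        rw [← Finset.sum_mul, hsplit _ (Real.sqrt_nonneg S), Real.sq_sqrt hS0]

theorem continuous_gradH2 {n : ℕ} {u : Heis n → ℝ} (hu : ContDiff ℝ 1 u) :
    Continuous (gradH2 u) := by
  have hd : ∀ w, Continuous fun ξ => fderiv ℝ u ξ w := fun w =>
    (hu.continuous_fderiv one_ne_zero).clm_apply continuous_const
  unfold gradH2 Xd Yd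
  fun_prop

/-- Theorem 2 of the paper: the `L^p` Hardy inequality, `p ≥ 2`, on the
half-space `Π⁺_{ν,d}`, with sharp constant `((p−1)/p)^p`; here `|∇_{ℍⁿ} u| = (gradH2 u)^{1/2}`
and `dist(ξ, ∂Π⁺_{ν,d}) = ⟨ξ,ν⟩ − d`. Powers are real powers. -/
theorem hardy_halfspace_Lp (n : ℕ) (hn : 1 ≤ n) (p : ℝ) (hp : 2 ≤ p)
    (ν : Heis n) (hν : ‖ν‖ = 1) (d : ℝ)
    (u : Heis n → ℝ) (hu : ContDiff ℝ (⊤ : ℕ∞) u) (hc : HasCompactSupport u)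
    (hsupp : tsupport u ⊆ {ξ : Heis n | d < ⟪ξ, ν⟫}) :
    ∫ ξ in {ξ : Heis n | d < ⟪ξ, ν⟫}, Real.sqrt (gradH2 u ξ) ^ p ≥
      ((p - 1) / p) ^ p * ∫ ξ in {ξ : Heis n | d < ⟪ξ, ν⟫},
        (∑ i : Fin n, (|XiNu i ξ ν| ^ p + |YiNu i ξ ν| ^ p)) / (⟪ξ, ν⟫ - d) ^ p
          * |u ξ| ^ p := by
  have hu1 : ContDiff ℝ 1 u := hu.of_le (by exact_mod_cast le_top)
  have hp0 : 0 < p := by linarith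
  have hp1 : 1 < p := by linarith
  set U := {ξ : Heis n | d < ⟪ξ, ν⟫} with hUdef
  have hinner : ∀ j : Fin (2 * n + 1), ⟪(EuclideanSpace.single j 1 : Heis n), ν⟫ = ν j :=
    fun j => by simp [EuclideanSpace.inner_single_left]
  have hxy : ∀ i : Fin n, (xIdx i : Fin (2 * n + 1)) ≠ yIdx i := fun i => by
    have := i.2; simp only [xIdx, yIdx, ne_eq, Fin.mk.injEq]; omega
  have hxt : ∀ i : Fin n, (xIdx i : Fin (2 * n + 1)) ≠ tIdx n := fun i => by
    have := i.2; simp only [xIdx, tIdx, ne_eq, Fin.mk.injEq]; omega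
  have hyt : ∀ i : Fin n, (yIdx i : Fin (2 * n + 1)) ≠ tIdx n := fun i => by
    have := i.2; simp only [yIdx, tIdx, ne_eq, Fin.mk.injEq]; omega
  have hX : ∀ i : Fin n, ((p - 1) / p) ^ p *
      ∫ ξ in U, |XiNu i ξ ν| ^ p / (⟪ξ, ν⟫ - d) ^ p * |u ξ| ^ p ≤ ∫ ξ in U, |Xd i u ξ| ^ p := by
    intro i
    have := hardy_halfspace_field hp hu1 hc hsupp (EuclideanSpace.single (xIdx i) 1)
      (EuclideanSpace.single (tIdx n) 1) (b := fun ξ => 2 * ξ (yIdx i)) (by fun_prop)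
      (fun ξ s => by simp [(hxy i).symm]) (fun ξ s => by simp [hyt i])
    simpa only [hinner, XiNu, Xd] using this
  have hY : ∀ i : Fin n, ((p - 1) / p) ^ p *
      ∫ ξ in U, |YiNu i ξ ν| ^ p / (⟪ξ, ν⟫ - d) ^ p * |u ξ| ^ p ≤ ∫ ξ in U, |Yd i u ξ| ^ p := by
    intro i
    have := hardy_halfspace_field hp hu1 hc hsupp (EuclideanSpace.single (yIdx i) 1)
      (EuclideanSpace.single (tIdx n) 1) (b := fun ξ => -(2 * ξ (xIdx i))) (by fun_prop)
      (fun ξ s => by simp [hxy i]) (fun ξ s => by simp [hxt i])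
    simpa only [hinner, neg_mul, ← sub_eq_add_neg, YiNu, Yd] using this
  have iX : ∀ i : Fin n, IntegrableOn (fun ξ => |Xd i u ξ| ^ p) U := fun i =>
    (integrable_abs_fderiv_rpow hp0 hu1 hc _ _ (b := fun ξ => 2 * ξ (yIdx i))
      (by fun_prop)).integrableOn
  have iY : ∀ i : Fin n, IntegrableOn (fun ξ => |Yd i u ξ| ^ p) U := fun i => by
    have := (integrable_abs_fderiv_rpow hp0 hu1 hc (EuclideanSpace.single (yIdx i) 1)
      (EuclideanSpace.single (tIdx n) 1) (b := fun ξ => -(2 * ξ (xIdx i)))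
      (by fun_prop)).integrableOn (s := U)
    simpa only [neg_mul, ← sub_eq_add_neg, Yd] using this
  have jX : ∀ i : Fin n, IntegrableOn
      (fun ξ => |XiNu i ξ ν| ^ p / (⟪ξ, ν⟫ - d) ^ p * |u ξ| ^ p) U := fun i =>
    integrableOn_hardy_weight hp1 hu1 hc hsupp (by unfold XiNu; fun_prop)
  have jY : ∀ i : Fin n, IntegrableOn
      (fun ξ => |YiNu i ξ ν| ^ p / (⟪ξ, ν⟫ - d) ^ p * |u ξ| ^ p) U := fun i =>
    integrableOn_hardy_weight hp1 hu1 hc hsupp (by unfold YiNu; fun_prop)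
  have iXY : ∀ i : Fin n, IntegrableOn (fun ξ => |Xd i u ξ| ^ p + |Yd i u ξ| ^ p) U :=
    fun i => (iX i).add (iY i)
  have jXY : ∀ i : Fin n, IntegrableOn
      (fun ξ => |XiNu i ξ ν| ^ p / (⟪ξ, ν⟫ - d) ^ p * |u ξ| ^ p
        + |YiNu i ξ ν| ^ p / (⟪ξ, ν⟫ - d) ^ p * |u ξ| ^ p) U := fun i => (jX i).add (jY i)
  have hgrad : Integrable fun ξ => Real.sqrt (gradH2 u ξ) ^ p := by
    refine Continuous.integrable_of_hasCompactSupport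
      ((continuous_gradH2 hu1).sqrt.rpow_const fun _ => Or.inr hp0.le) ?_
    refine (hc.fderiv (𝕜 := ℝ)).mono fun ξ hξ hz => hξ ?_
    simp [gradH2, Xd, Yd, hz, Real.zero_rpow hp0.ne']
  calc ((p - 1) / p) ^ p * ∫ ξ in U,
        (∑ i : Fin n, (|XiNu i ξ ν| ^ p + |YiNu i ξ ν| ^ p)) / (⟪ξ, ν⟫ - d) ^ p * |u ξ| ^ p
      = ((p - 1) / p) ^ p * ∫ ξ in U, ∑ i : Fin n,
          (|XiNu i ξ ν| ^ p / (⟪ξ, ν⟫ - d) ^ p * |u ξ| ^ p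
            + |YiNu i ξ ν| ^ p / (⟪ξ, ν⟫ - d) ^ p * |u ξ| ^ p) := by
        simp only [Finset.sum_div, Finset.sum_mul, add_div, add_mul]
    _ = ∑ i : Fin n, (((p - 1) / p) ^ p *
            (∫ ξ in U, |XiNu i ξ ν| ^ p / (⟪ξ, ν⟫ - d) ^ p * |u ξ| ^ p)
          + ((p - 1) / p) ^ p *
            ∫ ξ in U, |YiNu i ξ ν| ^ p / (⟪ξ, ν⟫ - d) ^ p * |u ξ| ^ p) := by
        rw [integral_finsetSum _ fun i _ => jXY i, Finset.mul_sum]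
        refine Finset.sum_congr rfl fun i _ => ?_
        rw [integral_add (jX i) (jY i), mul_add]
    _ ≤ ∑ i : Fin n, ((∫ ξ in U, |Xd i u ξ| ^ p) + ∫ ξ in U, |Yd i u ξ| ^ p) :=
        Finset.sum_le_sum fun i _ => add_le_add (hX i) (hY i)
    _ = ∫ ξ in U, ∑ i : Fin n, (|Xd i u ξ| ^ p + |Yd i u ξ| ^ p) := by
        rw [integral_finsetSum _ fun i _ => iXY i]
        exact Finset.sum_congr rfl fun i _ => (integral_add (iX i) (iY i)).symm
    _ ≤ ∫ ξ in U, Real.sqrt (gradH2 u ξ) ^ p :=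
        integral_mono (integrable_finsetSum _ fun i _ => iXY i) hgrad.integrableOn
          fun ξ => sum_abs_rpow_le_sqrt_sum_sq_rpow _ hp _ _
end
end

section
/- Let n ≥ 1, p ≥ 2, and let Ω ⊂ ℝ^{2n+1} be an open convex domain. For ξ ∈ Ω let ν(ξ) ∈ S^{2n} denote the outer unit normal of ∂Ω at a point ξ̂ ∈ ∂Ω realizing the Euclidean distance, i.e. dist(ξ, ∂Ω) = |ξ − ξ̂| and ξ̂ = ξ + dist(ξ, ∂Ω)ν(ξ). Then for every u ∈ C_0^∞(Ω) one has ∫_Ω |∇_{ℍⁿ} u|^p dξ ≥ ((p−1)/p)^p ∫_Ω Σ_{i=1}^n (|⟨X_i(ξ), ν(ξ)⟩|^p + |⟨Y_i(ξ), ν(ξ)⟩|^p) / dist(ξ, ∂Ω)^p · |u|^p dξ, where dist(ξ, ∂Ω) is the Euclidean distance from ξ to ∂Ω. -/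
open MeasureTheory RealInnerProductSpace

noncomputable section

open Metric Filter Topology Set

section Geometry

lemma infDist_frontier_pos {X : Type*} [PseudoMetricSpace X] {s : Set X} (hs : IsOpen s)
    (hne : (frontier s).Nonempty) {x : X} (hx : x ∈ s) : 0 < infDist x (frontier s) := by
  refine (isClosed_frontier.notMem_iff_infDist_pos hne).1 fun h => ?_
  rw [hs.frontier_eq] at h
  exact h.2 hx

variable {E : Type*} [NormedAddCommGroup E] [InnerProductSpace ℝ E] [FiniteDimensional ℝ E]

lemma infDist_frontier_le_dist {s : Set E} {x z : E} (hx : x ∈ s) (hz : z ∉ s) :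
    infDist x (frontier s) ≤ dist x z := by
  obtain ⟨y, hy, hxy⟩ := exists_mem_frontier_infDist_compl_eq_dist hx
    (fun h => hz (h ▸ mem_univ z))
  calc infDist x (frontier s) ≤ dist x y := infDist_le_dist_of_mem hy
    _ = infDist x sᶜ := hxy.symm
    _ ≤ dist x z := infDist_le_dist_of_mem hz

/-- The distance to the boundary of an open convex set lies below its affine majorant given by an
outer unit normal at a nearest boundary point. -/
lemma infDist_frontier_le_sub_inner {s : Set E} (hs : IsOpen s) (hconv : Convex ℝ s) {x y w : E}
    (hx : x ∈ s) (hy : y ∈ s) (hw : ‖w‖ = 1)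
    (hxw : x + infDist x (frontier s) • w ∈ frontier s) :
    infDist y (frontier s) ≤ infDist x (frontier s) - inner ℝ w (y - x) := by
  set r := infDist x (frontier s) with hr
  have hrpos : 0 < r := infDist_frontier_pos hs ⟨_, hxw⟩ hx
  have hnot : x + r • w ∉ s := by
    rw [hs.frontier_eq] at hxw
    exact hxw.2
  obtain ⟨f, hf⟩ := geometric_hahn_banach_open_point hconv hs hnot
  obtain ⟨g, rfl⟩ := (InnerProductSpace.toDual ℝ E).surjective f
  simp only [InnerProductSpace.toDual_apply_apply] at hf
  have hg : 0 < ‖g‖ := by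
    rw [norm_pos_iff]
    rintro rfl
    simpa using hf x hx
  have hball : ball x r ⊆ s := fun z hz => by
    by_contra hzs
    have := infDist_frontier_le_dist hx hzs
    rw [mem_ball, dist_comm] at hz
    linarith
  have hle : inner ℝ g (x + (r / ‖g‖) • g) ≤ inner ℝ g (x + r • w) := by
    have hmem : x + (r / ‖g‖) • g ∈ closure (ball x r) := by
      rw [closure_ball x hrpos.ne', mem_closedBall, dist_eq_norm, add_sub_cancel_left, norm_smul,
        Real.norm_of_nonneg (by positivity), div_mul_cancel₀ _ hg.ne']
    refine closure_minimal (t := {z | inner ℝ g z ≤ inner ℝ g (x + r • w)})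
      (fun z hz => (hf z (hball hz)).le) (isClosed_le (by fun_prop) continuous_const) hmem
  have hgw : ‖g‖ ≤ inner ℝ g w := by
    simp only [inner_add_right, inner_smul_right, real_inner_self_eq_norm_sq] at hle
    have h1 : r / ‖g‖ * ‖g‖ ^ 2 = r * ‖g‖ := by field_simp
    rw [h1] at hle
    exact le_of_mul_le_mul_left (by linarith) hrpos
  have hgeq : g = ‖g‖ • w := by
    have h2 : inner ℝ g w = ‖g‖ * ‖w‖ :=
      le_antisymm (real_inner_le_norm g w) (by rw [hw, mul_one]; exact hgw)
    have h3 := inner_eq_norm_mul_iff_real.1 h2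
    rw [hw, one_smul] at h3
    exact h3
  have hhalf : ∀ z ∈ s, inner ℝ w z < inner ℝ w (x + r • w) := fun z hz => by
    have h4 := hf z hz
    rw [hgeq, inner_smul_left, inner_smul_left] at h4
    exact lt_of_mul_lt_mul_left h4 (by simp)
  have hww : inner ℝ w w = (1 : ℝ) := by rw [real_inner_self_eq_norm_sq, hw, one_pow]
  set c : ℝ := r - inner ℝ w (y - x) with hc
  have hcpos : 0 < c := by
    have := hhalf y hy
    simp only [inner_add_right, inner_smul_right, hww, mul_one] at this
    rw [hc, inner_sub_right]
    linarith
  have hz : y + c • w ∉ s := fun h => by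
    have := hhalf _ h
    simp only [inner_add_right, inner_smul_right, hww, mul_one, hc, inner_sub_right] at this
    linarith
  calc infDist y (frontier s) ≤ dist y (y + c • w) := infDist_frontier_le_dist hy hz
    _ = c := by simp [norm_smul, hw, abs_of_pos hcpos]

lemma fderiv_infDist_frontier_of_differentiableAt {s : Set E} (hs : IsOpen s) (hconv : Convex ℝ s)
    {x w : E} (hx : x ∈ s) (hw : ‖w‖ = 1)
    (hxw : x + infDist x (frontier s) • w ∈ frontier s)
    (hdiff : DifferentiableAt ℝ (fun y => infDist y (frontier s)) x) (z : E) :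
    fderiv ℝ (fun y => infDist y (frontier s)) x z = -inner ℝ w z := by
  have hmax : IsLocalMax (fun y => infDist y (frontier s) + innerSL ℝ w y) x := by
    filter_upwards [hs.mem_nhds hx] with y hy
    have := infDist_frontier_le_sub_inner hs hconv hx hy hw hxw
    rw [inner_sub_right] at this
    simp only [innerSL_apply_apply]
    linarith
  have h0 := hmax.hasFDerivAt_eq_zero (hdiff.hasFDerivAt.add (innerSL ℝ w).hasFDerivAt)
  have := congrArg (fun L : E →L[ℝ] ℝ => L z) h0
  simp only [add_apply, innerSL_apply_apply, zero_apply]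
    at this
  linarith

end Geometry

section Flow

variable {E : Type*} [NormedAddCommGroup E] [NormedSpace ℝ E]

/-- The affine vector field `x ↦ a + ℓ x • b`. -/
def affField (ℓ : E →L[ℝ] ℝ) (a b x : E) : E := a + ℓ x • b

/-- The time `h` flow of `affField ℓ a b`, when `ℓ a = ℓ b = 0`. -/
def affFlow (ℓ : E →L[ℝ] ℝ) (a b : E) (h : ℝ) (x : E) : E := x + h • affField ℓ a b x

variable {ℓ : E →L[ℝ] ℝ} {a b : E}

lemma continuous_affField : Continuous (affField ℓ a b) := by
  unfold affField
  fun_prop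

lemma continuous_uncurry_affFlow : Continuous fun q : ℝ × E => affFlow ℓ a b q.1 q.2 := by
  unfold affFlow affField
  fun_prop

lemma continuous_affFlow (h : ℝ) : Continuous (affFlow ℓ a b h) :=
  continuous_uncurry_affFlow.comp (by fun_prop : Continuous fun x : E => (h, x))

@[simp] lemma affFlow_zero (x : E) : affFlow ℓ a b 0 x = x := by simp [affFlow]

lemma affField_affFlow (ha : ℓ a = 0) (hb : ℓ b = 0) (h : ℝ) (x : E) :
    affField ℓ a b (affFlow ℓ a b h x) = affField ℓ a b x := by
  simp [affField, affFlow, ha, hb]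

lemma affFlow_affFlow (ha : ℓ a = 0) (hb : ℓ b = 0) (h k : ℝ) (x : E) :
    affFlow ℓ a b h (affFlow ℓ a b k x) = affFlow ℓ a b (h + k) x := by
  rw [affFlow, affField_affFlow ha hb, affFlow, affFlow, add_smul]
  abel

lemma affFlow_neg_affFlow (ha : ℓ a = 0) (hb : ℓ b = 0) (h : ℝ) (x : E) :
    affFlow ℓ a b (-h) (affFlow ℓ a b h x) = x := by
  rw [affFlow_affFlow ha hb, neg_add_cancel, affFlow_zero]

lemma affField_neg_neg (x : E) : affField ℓ (-a) (-b) x = -affField ℓ a b x := by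
  simp only [affField, smul_neg]
  abel

lemma affFlow_neg_neg (h : ℝ) (x : E) : affFlow ℓ (-a) (-b) h x = affFlow ℓ a b (-h) x := by
  simp [affFlow, affField_neg_neg]

variable [MeasurableSpace E] [BorelSpace E] [FiniteDimensional ℝ E]

lemma measurableEmbedding_affFlow (ha : ℓ a = 0) (hb : ℓ b = 0) (h : ℝ) :
    MeasurableEmbedding (affFlow ℓ a b h) :=
  (continuous_affFlow h).measurableEmbedding
    (Function.LeftInverse.injective (g := affFlow ℓ a b (-h)) (affFlow_neg_affFlow ha hb h))

lemma measurePreserving_affFlow (μ : Measure E) [μ.IsAddHaarMeasure] (hb : ℓ b = 0) (h : ℝ) :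
    MeasurePreserving (affFlow ℓ a b h) μ μ := by
  have hdet : LinearMap.det (LinearMap.transvection (h • ℓ.toLinearMap) b) = 1 := by
    rw [LinearMap.transvection.det]
    simp [hb]
  have hlin : MeasurePreserving (LinearMap.transvection (h • ℓ.toLinearMap) b) μ μ := by
    refine ⟨(LinearMap.continuous_of_finiteDimensional _).measurable, ?_⟩
    rw [Measure.map_linearMap_addHaar_eq_smul_addHaar μ (by rw [hdet]; exact one_ne_zero), hdet]
    simp
  have hcomp := (measurePreserving_add_right μ (h • a)).comp hlin
  convert hcomp using 1
  ext x
  simp only [affFlow, affField, Function.comp_apply, LinearMap.transvection.apply,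
    LinearMap.smul_apply, ContinuousLinearMap.coe_coe, smul_add, smul_smul, smul_eq_mul]
  abel

end Flow

section Pointwise

lemma rpow_one_sub_mul_rpow_add_le {p h d d' m m' : ℝ} (hp : 2 ≤ p) (hh : 0 < h) (hd : 0 < d)
    (hd' : 0 < d') (hm : 0 < m) (hmm : m ≤ m') (hdd : d' ≤ d - h * m) :
    d ^ (1 - p) * m ^ (p - 1) + h * ((p - 1) * (m ^ p / d ^ p)) ≤ d' ^ (1 - p) * m' ^ (p - 1) := by
  set x := h * m / d with hx
  have hx0 : 0 < x := by positivity
  have hdx : d * (1 - x) = d - h * m := by rw [hx]; field_simp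
  have hx1 : 0 < 1 - x := by
    have : 0 < d * (1 - x) := by rw [hdx]; linarith
    exact pos_of_mul_pos_right this hd.le
  have h1 : 1 + (p - 1) * x ≤ (1 - x) ^ (1 - p) := by
    have e : (1 - x) ^ (1 - p) = ((1 - x)⁻¹) ^ (p - 1) := by
      rw [Real.inv_rpow hx1.le, ← Real.rpow_neg hx1.le, neg_sub]
    rw [e]
    calc 1 + (p - 1) * x ≤ (1 + x) ^ (p - 1) :=
          one_add_mul_self_le_rpow_one_add (by linarith) (by linarith)
      _ ≤ ((1 - x)⁻¹) ^ (p - 1) := by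
          refine Real.rpow_le_rpow (by positivity) ?_ (by linarith)
          rw [← one_div, le_div_iff₀ hx1]
          nlinarith
  have h2 : d ^ (1 - p) * (1 + (p - 1) * x) ≤ d' ^ (1 - p) :=
    calc d ^ (1 - p) * (1 + (p - 1) * x) ≤ d ^ (1 - p) * (1 - x) ^ (1 - p) := by gcongr
      _ = (d - h * m) ^ (1 - p) := by rw [← Real.mul_rpow hd.le hx1.le, hdx]
      _ ≤ d' ^ (1 - p) := Real.rpow_le_rpow_of_nonpos hd' hdd (by linarith)
  have h3 : m ^ (p - 1) ≤ m' ^ (p - 1) := Real.rpow_le_rpow hm.le hmm (by linarith)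
  have h4 : d ^ (1 - p) * (1 + (p - 1) * x) * m ^ (p - 1) ≤ d' ^ (1 - p) * m' ^ (p - 1) :=
    mul_le_mul h2 h3 (by positivity) (by positivity)
  refine le_trans (le_of_eq ?_) h4
  have e1 : d ^ (1 - p) = d / d ^ p := by rw [Real.rpow_sub hd, Real.rpow_one]
  have e2 : m ^ (p - 1) = m ^ p / m := by rw [Real.rpow_sub hm, Real.rpow_one]
  rw [e1, e2, hx]
  field_simp

lemma rpow_add_mul_sub_le_rpow {p b c : ℝ} (hp : 2 ≤ p) (hb : 0 ≤ b) (hc : 0 ≤ c) :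
    c ^ p + p * c ^ (p - 1) * (b - c) ≤ b ^ p := by
  rcases hc.eq_or_lt with rfl | hc
  · rw [Real.zero_rpow (by linarith), Real.zero_rpow (by linarith)]
    simpa using Real.rpow_nonneg hb p
  · have h1 := one_add_mul_self_le_rpow_one_add (s := b / c - 1)
      (by have : 0 ≤ b / c := by positivity
          linarith) (p := p) (by linarith)
    rw [add_sub_cancel, Real.div_rpow hb hc.le, le_div_iff₀ (by positivity)] at h1
    refine le_trans (le_of_eq ?_) h1
    rw [Real.rpow_sub hc, Real.rpow_one]
    field_simp

lemma abs_rpow_eq_max_rpow_add {p : ℝ} (hp : 0 < p) (m : ℝ) :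
    |m| ^ p = max m 0 ^ p + max (-m) 0 ^ p := by
  rcases le_total 0 m with h | h
  · rw [max_eq_left h, max_eq_right (by linarith), Real.zero_rpow hp.ne', abs_of_nonneg h, add_zero]
  · rw [max_eq_right h, max_eq_left (by linarith), Real.zero_rpow hp.ne', abs_of_nonpos h, zero_add]

/-- Young's inequality in the form used for the `L^p` Hardy inequality. -/
lemma young_hardy {p d m t b : ℝ} (hp : 2 ≤ p) (hd : 0 < d) :
    ((p - 1) / p) ^ (p - 1) * (d ^ (1 - p) * |m| ^ (p - 1) * (p * |t| ^ (p - 1) * |b|)) ≤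
      |b| ^ p + (p - 1) * ((p - 1) / p) ^ p * (|m| ^ p / d ^ p * |t| ^ p) := by
  have hk : 0 < (p - 1) / p := div_pos (by linarith) (by linarith)
  set k := (p - 1) / p with hkdef
  set a := |m| * |t| / d with ha
  have ha0 : 0 ≤ a := by positivity
  have h := rpow_add_mul_sub_le_rpow hp (abs_nonneg b) (c := k * a) (by positivity)
  have e1 : a ^ (p - 1) = d ^ (1 - p) * |m| ^ (p - 1) * |t| ^ (p - 1) := by
    rw [ha, Real.div_rpow (by positivity) hd.le, Real.mul_rpow (abs_nonneg _) (abs_nonneg _),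
      ← neg_sub p 1, Real.rpow_neg hd.le]
    field_simp
  have e2 : a ^ p = |m| ^ p / d ^ p * |t| ^ p := by
    rw [ha, Real.div_rpow (by positivity) hd.le, Real.mul_rpow (abs_nonneg _) (abs_nonneg _)]
    field_simp
  have e3 : ∀ y : ℝ, 0 ≤ y → y ^ (p - 1) * y = y ^ p := fun y hy => by
    rw [← Real.rpow_add_one' hy (by linarith), sub_add_cancel]
  have e4 : (k * a) ^ (p - 1) * (k * a) = k ^ p * a ^ p := by
    rw [e3 _ (by positivity), Real.mul_rpow hk.le ha0]
  have e5 : (k * a) ^ p = k ^ p * a ^ p := Real.mul_rpow hk.le ha0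
  have e6 : (k * a) ^ (p - 1) = k ^ (p - 1) * a ^ (p - 1) := Real.mul_rpow hk.le ha0
  rw [← e2]
  have e7 : k ^ (p - 1) * (d ^ (1 - p) * |m| ^ (p - 1) * (p * |t| ^ (p - 1) * |b|)) =
      p * (k * a) ^ (p - 1) * |b| := by rw [e6, e1]; ring
  rw [e7]
  rw [e5] at h
  nlinarith [h, e4]

lemma sum_rpow_le_rpow_sum {ι : Type*} (s : Finset ι) {q : ℝ} (hq : 1 ≤ q) {f : ι → ℝ}
    (hf : ∀ i ∈ s, 0 ≤ f i) : ∑ i ∈ s, f i ^ q ≤ (∑ i ∈ s, f i) ^ q := by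
  classical
  induction s using Finset.induction_on with
  | empty => simp [Real.zero_rpow (by linarith : q ≠ 0)]
  | insert i s hi ih =>
    rw [Finset.sum_insert hi, Finset.sum_insert hi]
    have hs : ∀ j ∈ s, 0 ≤ f j := fun j hj => hf j (Finset.mem_insert_of_mem hj)
    calc f i ^ q + ∑ j ∈ s, f j ^ q ≤ f i ^ q + (∑ j ∈ s, f j) ^ q := by gcongr; exact ih hs
      _ ≤ (f i + ∑ j ∈ s, f j) ^ q :=
        Real.add_rpow_le_rpow_add (hf i (Finset.mem_insert_self _ _)) (Finset.sum_nonneg hs) hq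

lemma sum_abs_rpow_le_sqrt_rpow {ι : Type*} (s : Finset ι) {p : ℝ} (hp : 2 ≤ p) (f g : ι → ℝ) :
    ∑ i ∈ s, (|f i| ^ p + |g i| ^ p) ≤ Real.sqrt (∑ i ∈ s, (f i ^ 2 + g i ^ 2)) ^ p := by
  have hsq : ∀ y : ℝ, |y| ^ p = (y ^ 2) ^ (p / 2) := fun y => by
    rw [← sq_abs, ← Real.rpow_natCast_mul (abs_nonneg y)]
    congr 1
    push_cast
    ring
  have hsum : 0 ≤ ∑ i ∈ s, (f i ^ 2 + g i ^ 2) := Finset.sum_nonneg fun i _ => by positivity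
  calc ∑ i ∈ s, (|f i| ^ p + |g i| ^ p) ≤ ∑ i ∈ s, (f i ^ 2 + g i ^ 2) ^ (p / 2) := by
        refine Finset.sum_le_sum fun i _ => ?_
        rw [hsq, hsq]
        exact Real.add_rpow_le_rpow_add (by positivity) (by positivity) (by linarith)
    _ ≤ (∑ i ∈ s, (f i ^ 2 + g i ^ 2)) ^ (p / 2) :=
        sum_rpow_le_rpow_sum s (by linarith) fun i _ => by positivity
    _ = Real.sqrt (∑ i ∈ s, (f i ^ 2 + g i ^ 2)) ^ p := by
        rw [Real.sqrt_eq_rpow, ← Real.rpow_mul hsum]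
        congr 1
        ring

end Pointwise

section Hardy

section Weights

variable {X : Type*} [TopologicalSpace X] [T2Space X] [MeasurableSpace X] [BorelSpace X]
  {μ : Measure X} [IsFiniteMeasureOnCompacts μ]

lemma integrable_of_norm_le_on_compact {f g : X → ℝ} {K : Set X}
    (hf : AEMeasurable f μ) (hK : IsCompact K) (hg : ContinuousOn g K)
    (hfg : ∀ x ∈ K, |f x| ≤ g x) (hf0 : ∀ x ∉ K, f x = 0) : Integrable f μ := by
  have hgi : Integrable (K.indicator g) μ :=
    (hg.integrableOn_compact hK).integrable_indicator hK.measurableSet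
  refine hgi.mono' hf.aestronglyMeasurable (Eventually.of_forall fun x => ?_)
  by_cases hx : x ∈ K
  · simpa [hx] using hfg x hx
  · simp [hx, hf0 x hx]

/-- Weights of the form `W * N ^ q * φ` with `φ` continuous and compactly supported in `Ω`. -/
lemma integrable_mul_rpow_mul {Ω : Set X} {W N B φ : X → ℝ} {q : ℝ} (hq : 0 ≤ q)
    (hW : Measurable W) (hWc : ContinuousOn W Ω) (hN : AEMeasurable N μ) (hN0 : ∀ x, 0 ≤ N x)
    (hB : Continuous B) (hNB : ∀ x ∈ Ω, N x ≤ B x)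
    (hφ : Continuous φ) (hφc : HasCompactSupport φ) (hφΩ : tsupport φ ⊆ Ω) :
    Integrable (fun x => W x * N x ^ q * φ x) μ := by
  refine integrable_of_norm_le_on_compact (K := tsupport φ)
    (g := fun x => |W x| * B x ^ q * |φ x|)
    ((hW.aemeasurable.mul (hN.pow_const _)).mul hφ.measurable.aemeasurable) hφc.isCompact
    (((hWc.mono hφΩ).abs.mul (hB.continuousOn.rpow_const fun x _ => .inr hq)).mul
      hφ.abs.continuousOn) (fun x hx => ?_)
    fun x hx => by simp [image_eq_zero_of_notMem_tsupport hx]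
  rw [abs_mul, abs_mul, abs_of_nonneg (Real.rpow_nonneg (hN0 x) q)]
  have h1 : N x ^ q ≤ B x ^ q := Real.rpow_le_rpow (hN0 x) (hNB x (hφΩ hx)) hq
  gcongr

lemma integrable_rpow_div_rpow_mul {Ω : Set X} {d N B φ : X → ℝ} {p : ℝ} (hp : 0 ≤ p)
    (hdc : Continuous d) (hd : ∀ x ∈ Ω, 0 < d x) (hN : AEMeasurable N μ) (hN0 : ∀ x, 0 ≤ N x)
    (hB : Continuous B) (hNB : ∀ x ∈ Ω, N x ≤ B x)
    (hφ : Continuous φ) (hφc : HasCompactSupport φ) (hφΩ : tsupport φ ⊆ Ω) :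
    Integrable (fun x => N x ^ p / d x ^ p * φ x) μ := by
  simp_rw [div_eq_inv_mul]
  exact integrable_mul_rpow_mul hp (hdc.measurable.pow_const _).inv
    ((hdc.continuousOn.rpow_const fun x hx => .inl (hd x hx).ne').inv₀
      fun x hx => (Real.rpow_pos_of_pos (hd x hx) _).ne') hN hN0 hB hNB hφ hφc hφΩ

end Weights

variable {E : Type*} [NormedAddCommGroup E] [NormedSpace ℝ E]

lemma exists_compact_affFlow {ℓ : E →L[ℝ] ℝ} {a b : E} {Ω K : Set E}
    (hΩ : IsOpen Ω) (hK : IsCompact K) (hKΩ : K ⊆ Ω) :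
    ∃ δ > 0, ∃ K' ⊆ Ω, IsCompact K' ∧ ∀ h : ℝ, |h| ≤ δ → ∀ x ∈ K, affFlow ℓ a b h x ∈ K' := by
  have hev : ∀ᶠ h : ℝ in 𝓝 0, ∀ x ∈ K, affFlow ℓ a b h x ∈ Ω :=
    hK.eventually_forall_of_forall_eventually fun x hx =>
      continuous_uncurry_affFlow.continuousAt.eventually_mem
        (hΩ.mem_nhds (by simpa using hKΩ hx))
  obtain ⟨δ, hδ, hball⟩ := nhds_basis_closedBall.eventually_iff.1 hev
  refine ⟨δ, hδ, (fun q : ℝ × E => affFlow ℓ a b q.1 q.2) '' (closedBall 0 δ ×ˢ K), ?_,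
    ((isCompact_closedBall _ _).prod hK).image continuous_uncurry_affFlow, ?_⟩
  · rintro _ ⟨⟨h, x⟩, ⟨hh, hx⟩, rfl⟩
    exact hball hh x hx
  · exact fun h hh x hx => ⟨(h, x), ⟨by simpa using hh, hx⟩, rfl⟩

lemma tsupport_fderiv_apply_field_subset (f : E → ℝ) (w : E → E) :
    tsupport (fun x => fderiv ℝ f x (w x)) ⊆ tsupport f := by
  refine closure_minimal (fun x hx => ?_) isClosed_closure
  by_contra h
  exact hx (by simp [fderiv_of_notMem_tsupport (𝕜 := ℝ) h])

variable [MeasurableSpace E] [BorelSpace E] [FiniteDimensional ℝ E]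
  {μ : Measure E} [μ.IsAddHaarMeasure]

/-- One-sided weighted inequality along the flow of an affine field: `d` plays the role of a
function concave along flow lines, with supergradient `M`. -/
lemma integral_posPart_rpow_le {ℓ : E →L[ℝ] ℝ} {a b : E} (ha : ℓ a = 0) (hb : ℓ b = 0)
    {p : ℝ} (hp : 2 ≤ p) {Ω : Set E} (hΩ : IsOpen Ω) {d M ψ : E → ℝ} (hdc : Continuous d)
    (hd : ∀ x ∈ Ω, 0 < d x) (hM : AEMeasurable M μ)
    (hMb : ∀ x ∈ Ω, |M x| ≤ ‖affField ℓ a b x‖)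
    (hsup : ∀ x ∈ Ω, ∀ h, affFlow ℓ a b h x ∈ Ω → d (affFlow ℓ a b h x) ≤ d x + h * M x)
    (hψ : ContDiff ℝ 1 ψ) (hψc : HasCompactSupport ψ) (hψΩ : tsupport ψ ⊆ Ω)
    (hψ0 : ∀ x, 0 ≤ ψ x) :
    (p - 1) * ∫ x, max (M x) 0 ^ p / d x ^ p * ψ x ∂μ ≤
      ∫ x, d x ^ (1 - p) * max (M x) 0 ^ (p - 1) * fderiv ℝ ψ x (affField ℓ a b x) ∂μ := by
  obtain ⟨δ, hδ, K, hKΩ, hK, hflow⟩ :=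
    exists_compact_affFlow (ℓ := ℓ) (a := a) (b := b) hΩ hψc.isCompact hψΩ
  have hsuppK : tsupport ψ ⊆ K := fun x hx => by
    simpa using hflow 0 (by simpa using hδ.le) x hx
  have hψz : ∀ x ∉ K, ψ x = 0 := fun x hx => image_eq_zero_of_notMem_tsupport fun h => hx (hsuppK h)
  have hψhz : ∀ h, |h| ≤ δ → ∀ x ∉ K, ψ (affFlow ℓ a b h x) = 0 := fun h hh x hx =>
    image_eq_zero_of_notMem_tsupport fun hmem => hx <| by
      simpa only [affFlow_neg_affFlow ha hb] using hflow (-h) (by simpa using hh) _ hmem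
  have hp1 : 0 < p - 1 := by linarith
  set G : E → ℝ := fun x => d x ^ (1 - p) * max (M x) 0 ^ (p - 1) with hG
  set V : E → ℝ := fun x => d x ^ (1 - p) * ‖affField ℓ a b x‖ ^ (p - 1) with hV
  have hmaxb : ∀ x ∈ Ω, max (M x) 0 ≤ ‖affField ℓ a b x‖ := fun x hx =>
    max_le ((le_abs_self _).trans (hMb x hx)) (norm_nonneg _)
  have hG0 : ∀ x ∈ Ω, 0 ≤ G x := fun x hx => by have := hd x hx; positivity
  have hGm : AEMeasurable G μ :=
    (hdc.measurable.pow_const _).aemeasurable.mul ((hM.max aemeasurable_const).pow_const _)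
  have hGV : ∀ x ∈ Ω, |G x| ≤ V x := fun x hx => by
    rw [abs_of_nonneg (hG0 x hx)]
    have := hd x hx
    exact mul_le_mul_of_nonneg_left
      (Real.rpow_le_rpow (le_max_right _ _) (hmaxb x hx) hp1.le) (by positivity)
  have hvc : Continuous (affField ℓ a b) := continuous_affField
  have hVc : ContinuousOn V K :=
    (hdc.continuousOn.rpow_const fun x hx => .inl (hd x (hKΩ hx)).ne').mul
      (hvc.norm.continuousOn.rpow_const fun x _ => .inr hp1.le)
  have hint : ∀ h, |h| ≤ δ → Integrable (fun x => G x * ψ (affFlow ℓ a b h x)) μ := fun h hh => by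
    have hc := hψ.continuous.comp (continuous_affFlow (ℓ := ℓ) (a := a) (b := b) h)
    refine integrable_of_norm_le_on_compact (g := fun x => V x * |ψ (affFlow ℓ a b h x)|)
      (hGm.mul hc.measurable.aemeasurable) hK (hVc.mul hc.abs.continuousOn) (fun x hx => ?_)
      fun x hx => by simp [hψhz h hh x hx]
    rw [abs_mul]
    exact mul_le_mul_of_nonneg_right (hGV x (hKΩ hx)) (abs_nonneg _)
  have hint0 : Integrable (fun x => G x * ψ x) μ := by
    simpa using hint 0 (by simpa using hδ.le)
  have hintL : Integrable (fun x => max (M x) 0 ^ p / d x ^ p * ψ x) μ :=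
    integrable_rpow_div_rpow_mul (by linarith) hdc hd (hM.max aemeasurable_const)
      (fun _ => le_max_right _ _) hvc.norm hmaxb hψ.continuous hψc hψΩ
  have hanti : ∀ x ∈ Ω, ∀ h > 0, affFlow ℓ a b (-h) x ∈ Ω → M x ≤ M (affFlow ℓ a b (-h) x) := by
    intro x hx h hh hxh
    have h1 := hsup x hx (-h) hxh
    have e : affFlow ℓ a b h (affFlow ℓ a b (-h) x) = x := by
      simpa using affFlow_neg_affFlow ha hb (-h) x
    have h2 := hsup _ hxh h (by rwa [e])
    rw [e] at h2
    exact le_of_mul_le_mul_left (by linarith) hh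
  have hquot : ∀ h, 0 < h → h ≤ δ → (p - 1) * ∫ x, max (M x) 0 ^ p / d x ^ p * ψ x ∂μ ≤
      ∫ x, G x * (h⁻¹ * (ψ (affFlow ℓ a b h x) - ψ x)) ∂μ := by
    intro h hh hhδ
    have habs : |h| ≤ δ := by rwa [abs_of_pos hh]
    have hmp := measurePreserving_affFlow (ℓ := ℓ) (a := a) μ hb h
    have hme := measurableEmbedding_affFlow ha hb h
    set f : E → ℝ := fun x => G (affFlow ℓ a b (-h) x) * ψ x with hf
    have hcomp : ∀ x, f (affFlow ℓ a b h x) = G x * ψ (affFlow ℓ a b h x) := fun x => by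
      simp only [hf, affFlow_neg_affFlow ha hb]
    have hfi : Integrable f μ := by
      rw [← hmp.integrable_comp_emb hme]
      exact (hint h habs).congr (Eventually.of_forall fun x => (hcomp x).symm)
    have hshift : ∫ x, G x * ψ (affFlow ℓ a b h x) ∂μ = ∫ x, f x ∂μ := by
      rw [← hmp.integral_comp hme f]
      exact integral_congr_ae (Eventually.of_forall fun x => (hcomp x).symm)
    have hrhs : ∫ x, G x * (h⁻¹ * (ψ (affFlow ℓ a b h x) - ψ x)) ∂μ =
        ∫ x, h⁻¹ * (f x - G x * ψ x) ∂μ := by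
      rw [integral_const_mul, integral_sub hfi hint0, ← hshift,
        ← integral_sub (hint h habs) hint0, ← integral_const_mul]
      congr 1 with x
      ring
    rw [hrhs, ← integral_const_mul]
    refine integral_mono (hintL.const_mul _) ((hfi.sub hint0).const_mul _) fun x => ?_
    by_cases hx : x ∈ tsupport ψ
    · have hxΩ := hψΩ hx
      have hyΩ : affFlow ℓ a b (-h) x ∈ Ω := hKΩ (hflow (-h) (by simpa using habs) x hx)
      have key : G x + h * ((p - 1) * (max (M x) 0 ^ p / d x ^ p)) ≤ G (affFlow ℓ a b (-h) x) := by
        rcases le_or_gt (M x) 0 with hMx | hMx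
        · have : G x + h * ((p - 1) * (max (M x) 0 ^ p / d x ^ p)) = 0 := by
            simp only [hG, max_eq_right hMx]
            rw [Real.zero_rpow (by linarith), Real.zero_rpow (by linarith)]
            simp
          rw [this]
          exact hG0 _ hyΩ
        · have hle := hanti x hxΩ h hh hyΩ
          simp only [hG, max_eq_left hMx.le]
          rw [max_eq_left (hMx.le.trans hle)]
          refine rpow_one_sub_mul_rpow_add_le hp hh (hd x hxΩ) (hd _ hyΩ) hMx hle ?_
          have := hsup x hxΩ (-h) hyΩ
          linarith
      have h5 := mul_le_mul_of_nonneg_right key (hψ0 x)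
      simp only [hf]
      rw [inv_mul_eq_div, le_div_iff₀ hh]
      nlinarith [h5]
    · simp [hf, image_eq_zero_of_notMem_tsupport hx]
  have hlim : Tendsto (fun h : ℝ => ∫ x, G x * (h⁻¹ * (ψ (affFlow ℓ a b h x) - ψ x)) ∂μ) (𝓝[>] 0)
      (𝓝 (∫ x, G x * fderiv ℝ ψ x (affField ℓ a b x) ∂μ)) := by
    obtain ⟨C, hC⟩ := hψ.lipschitzWith_of_hasCompactSupport hψc one_ne_zero
    have hIoc : ∀ᶠ h : ℝ in 𝓝[>] 0, 0 < h ∧ h ≤ δ := by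
      filter_upwards [Ioc_mem_nhdsGT hδ] with h hh using hh
    refine tendsto_integral_filter_of_dominated_convergence
      (K.indicator fun x => V x * (C * ‖affField ℓ a b x‖)) ?_ ?_ ?_ ?_
    · refine Eventually.of_forall fun h => AEMeasurable.aestronglyMeasurable ?_
      have hc := hψ.continuous.comp (continuous_affFlow (ℓ := ℓ) (a := a) (b := b) h)
      exact hGm.mul ((hc.sub hψ.continuous).measurable.const_mul _).aemeasurable
    · filter_upwards [hIoc] with h hh
      refine Eventually.of_forall fun x => ?_
      by_cases hx : x ∈ K
      · rw [indicator_of_mem hx, Real.norm_eq_abs, abs_mul]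
        refine mul_le_mul (hGV x (hKΩ hx)) ?_ (abs_nonneg _)
          ((abs_nonneg _).trans (hGV x (hKΩ hx)))
        have h1 := hC.dist_le_mul (affFlow ℓ a b h x) x
        rw [Real.dist_eq, dist_eq_norm, affFlow, add_sub_cancel_left, norm_smul,
          Real.norm_of_nonneg hh.1.le] at h1
        rw [abs_mul, abs_inv, abs_of_pos hh.1, inv_mul_eq_div, div_le_iff₀ hh.1, affFlow]
        linarith
      · simp [hx, hψz x hx, hψhz h (by rw [abs_of_pos hh.1]; exact hh.2) x hx]
    · exact ((hVc.mul (continuousOn_const.mul hvc.norm.continuousOn)).integrableOn_compact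
        hK).integrable_indicator hK.measurableSet
    · refine Eventually.of_forall fun x => Tendsto.const_mul _ ?_
      have hline : HasDerivAt (fun h : ℝ => affFlow ℓ a b h x) (affField ℓ a b x) 0 := by
        simpa [affFlow] using ((hasDerivAt_id (0 : ℝ)).smul_const (affField ℓ a b x)).const_add x
      have hψd : HasFDerivAt ψ (fderiv ℝ ψ x) (affFlow ℓ a b 0 x) := by
        rw [affFlow_zero]
        exact (hψ.differentiable one_ne_zero x).hasFDerivAt
      simpa using (hψd.comp_hasDerivAt (0 : ℝ) hline).tendsto_slope_zero_right
  exact ge_of_tendsto hlim (by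
    filter_upwards [Ioc_mem_nhdsGT hδ] with h hh using hquot h hh.1 hh.2)


lemma integrable_abs_fderiv_apply_rpow {p : ℝ} (hp : 0 < p) {u : E → ℝ} (hu : ContDiff ℝ 1 u)
    (huc : HasCompactSupport u) {w : E → E} (hw : Continuous w) :
    Integrable (fun x => |fderiv ℝ u x (w x)| ^ p) μ := by
  have hc : HasCompactSupport fun x => fderiv ℝ u x (w x) :=
    huc.of_isClosed_subset isClosed_closure (tsupport_fderiv_apply_field_subset u w)
  exact ((((hu.continuous_fderiv one_ne_zero).clm_apply hw).abs.rpow_const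
    fun _ => .inr hp.le)).integrable_of_hasCompactSupport
    (hc.comp_left (g := fun t : ℝ => |t| ^ p) (by rw [abs_zero, Real.zero_rpow hp.ne']))

/-- The `L^p` Hardy inequality along an affine field, with abstract distance function `d` and
supergradient `M`. -/
lemma hardy_affFlow {ℓ : E →L[ℝ] ℝ} {a b : E} (ha : ℓ a = 0) (hb : ℓ b = 0)
    {p : ℝ} (hp : 2 ≤ p) {Ω : Set E} (hΩ : IsOpen Ω) {d M u : E → ℝ} (hdc : Continuous d)
    (hd : ∀ x ∈ Ω, 0 < d x) (hM : AEMeasurable M μ)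
    (hMb : ∀ x ∈ Ω, |M x| ≤ ‖affField ℓ a b x‖)
    (hsup : ∀ x ∈ Ω, ∀ h, affFlow ℓ a b h x ∈ Ω → d (affFlow ℓ a b h x) ≤ d x + h * M x)
    (hu : ContDiff ℝ 1 u) (huc : HasCompactSupport u) (huΩ : tsupport u ⊆ Ω) :
    Integrable (fun x => |M x| ^ p / d x ^ p * |u x| ^ p) μ ∧
      ((p - 1) / p) ^ p * ∫ x, |M x| ^ p / d x ^ p * |u x| ^ p ∂μ ≤
        ∫ x, |fderiv ℝ u x (affField ℓ a b x)| ^ p ∂μ := by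
  have hp0 : 0 < p := by linarith
  have hp1 : 0 < p - 1 := by linarith
  set ψ : E → ℝ := fun x => |u x| ^ p with hψdef
  have hψ : ContDiff ℝ 1 ψ := (contDiff_norm_rpow (E := ℝ) (by linarith : 1 < p)).comp hu
  have hzero : |(0 : ℝ)| ^ p = 0 := by rw [abs_zero, Real.zero_rpow hp0.ne']
  have hψc : HasCompactSupport ψ := huc.comp_left (g := fun t : ℝ => |t| ^ p) hzero
  have hψΩ : tsupport ψ ⊆ Ω :=
    (tsupport_comp_subset (g := fun t : ℝ => |t| ^ p) hzero u).trans huΩ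
  have hψ0 : ∀ x, 0 ≤ ψ x := fun x => by positivity
  have hvc : Continuous (affField ℓ a b) := continuous_affField
  have hdψc : Continuous fun x => fderiv ℝ ψ x (affField ℓ a b x) :=
    (hψ.continuous_fderiv one_ne_zero).clm_apply hvc
  have hsubψ : tsupport (fun x => fderiv ℝ ψ x (affField ℓ a b x)) ⊆ tsupport ψ :=
    tsupport_fderiv_apply_field_subset ψ _
  have hdψcs : HasCompactSupport fun x => fderiv ℝ ψ x (affField ℓ a b x) :=
    hψc.of_isClosed_subset isClosed_closure hsubψ
  have hIb : Integrable (fun x => |fderiv ℝ u x (affField ℓ a b x)| ^ p) μ :=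
    integrable_abs_fderiv_apply_rpow hp0 hu huc hvc
  have hL : ∀ {N : E → ℝ}, AEMeasurable N μ → (∀ x, 0 ≤ N x) →
      (∀ x ∈ Ω, N x ≤ ‖affField ℓ a b x‖) →
      Integrable (fun x => N x ^ p / d x ^ p * ψ x) μ := fun hN hN0 hNb =>
    integrable_rpow_div_rpow_mul hp0.le hdc hd hN hN0 hvc.norm hNb hψ.continuous hψc hψΩ
  have hR : ∀ {N : E → ℝ}, AEMeasurable N μ → (∀ x, 0 ≤ N x) →
      (∀ x ∈ Ω, N x ≤ ‖affField ℓ a b x‖) → Integrable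
        (fun x => d x ^ (1 - p) * N x ^ (p - 1) * fderiv ℝ ψ x (affField ℓ a b x)) μ :=
    fun hN hN0 hNb => integrable_mul_rpow_mul hp1.le (hdc.measurable.pow_const _)
      (hdc.continuousOn.rpow_const fun x hx => .inl (hd x hx).ne') hN hN0 hvc.norm hNb hdψc hdψcs
      (hsubψ.trans hψΩ)
  have hposm : AEMeasurable (fun x => max (M x) 0) μ := hM.max aemeasurable_const
  have hnegm : AEMeasurable (fun x => max (-M x) 0) μ := hM.neg.max aemeasurable_const
  have hposb : ∀ x ∈ Ω, max (M x) 0 ≤ ‖affField ℓ a b x‖ := fun x hx =>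
    max_le ((le_abs_self _).trans (hMb x hx)) (norm_nonneg _)
  have hnegb : ∀ x ∈ Ω, max (-M x) 0 ≤ ‖affField ℓ a b x‖ := fun x hx =>
    max_le ((neg_le_abs _).trans (hMb x hx)) (norm_nonneg _)
  have hA : Integrable (fun x => |M x| ^ p / d x ^ p * ψ x) μ :=
    hL hM.abs (fun _ => abs_nonneg _) hMb
  refine ⟨hA, ?_⟩
  have hpos := integral_posPart_rpow_le ha hb hp hΩ hdc hd hM hMb hsup hψ hψc hψΩ hψ0
  have hneg := integral_posPart_rpow_le (ℓ := ℓ) (a := -a) (b := -b) (M := fun x => -M x)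
    (by simp [ha]) (by simp [hb]) hp hΩ hdc hd hM.neg
    (fun x hx => by simpa [affField_neg_neg] using hMb x hx)
    (fun x hx h hxh => by
      rw [affFlow_neg_neg] at hxh ⊢
      have := hsup x hx (-h) hxh
      linarith) hψ hψc hψΩ hψ0
  simp only [affField_neg_neg, map_neg, mul_neg] at hneg
  rw [integral_neg] at hneg
  have hsplit : ∫ x, |M x| ^ p / d x ^ p * ψ x ∂μ =
      ∫ x, max (M x) 0 ^ p / d x ^ p * ψ x ∂μ + ∫ x, max (-M x) 0 ^ p / d x ^ p * ψ x ∂μ := by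
    rw [← integral_add (hL hposm (fun _ => le_max_right _ _) hposb)
      (hL hnegm (fun _ => le_max_right _ _) hnegb)]
    congr 1 with x
    rw [abs_rpow_eq_max_rpow_add hp0]
    ring
  have hk : 0 < (p - 1) / p := div_pos hp1 hp0
  set k := (p - 1) / p with hkdef
  have hyoung : k ^ (p - 1) *
      (∫ x, d x ^ (1 - p) * max (M x) 0 ^ (p - 1) * fderiv ℝ ψ x (affField ℓ a b x) ∂μ -
        ∫ x, d x ^ (1 - p) * max (-M x) 0 ^ (p - 1) * fderiv ℝ ψ x (affField ℓ a b x) ∂μ) ≤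
      ∫ x, |fderiv ℝ u x (affField ℓ a b x)| ^ p ∂μ +
        (p - 1) * k ^ p * ∫ x, |M x| ^ p / d x ^ p * ψ x ∂μ := by
    have hRp := hR hposm (fun _ => le_max_right _ _) hposb
    have hRn := hR hnegm (fun _ => le_max_right _ _) hnegb
    rw [← integral_sub hRp hRn, ← integral_const_mul, ← integral_const_mul,
      ← integral_add hIb (hA.const_mul _)]
    refine integral_mono ((hRp.sub hRn).const_mul _) (hIb.add (hA.const_mul _)) fun x => ?_
    by_cases hx : x ∈ tsupport ψ
    · have hdx := hd x (hψΩ hx)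
      refine le_trans ?_ (young_hardy (d := d x) (m := M x) (t := u x)
        (b := fderiv ℝ u x (affField ℓ a b x)) hp hdx)
      refine mul_le_mul_of_nonneg_left ?_ (by positivity)
      have hfd : |fderiv ℝ ψ x (affField ℓ a b x)| =
          p * |u x| ^ (p - 1) * |fderiv ℝ u x (affField ℓ a b x)| := by
        have h1 := (hasDerivAt_abs_rpow (u x) (by linarith : 1 < p)).comp_hasFDerivAt x
          (hu.differentiable one_ne_zero x).hasFDerivAt
        have h2 : fderiv ℝ ψ x = (p * |u x| ^ (p - 2) * u x) • fderiv ℝ u x := h1.fderiv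
        have h3 : |u x| ^ (p - 2) * |u x| = |u x| ^ (p - 1) := by
          rw [← Real.rpow_add_one' (abs_nonneg _) (by linarith)]
          ring_nf
        rw [h2, smul_apply, smul_eq_mul, abs_mul, abs_mul, abs_mul,
          abs_of_pos hp0, abs_of_nonneg (Real.rpow_nonneg (abs_nonneg (u x)) _), mul_assoc p, h3]
      rw [← hfd, ← sub_mul, ← mul_sub]
      refine (le_abs_self _).trans ?_
      rw [abs_mul, abs_mul, abs_of_pos (Real.rpow_pos_of_pos hdx _)]
      gcongr
      rw [abs_rpow_eq_max_rpow_add hp1]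
      refine (abs_sub _ _).trans (le_of_eq ?_)
      rw [abs_of_nonneg (Real.rpow_nonneg (le_max_right _ _) _),
        abs_of_nonneg (Real.rpow_nonneg (le_max_right _ _) _)]
    · have h1 : fderiv ℝ ψ x = 0 := fderiv_of_notMem_tsupport ℝ hx
      have h2 : ψ x = 0 := image_eq_zero_of_notMem_tsupport hx
      simp only [h1, h2, zero_apply, mul_zero, sub_zero, add_zero]
      positivity
  have hkk : k ^ (p - 1) * (p - 1) = p * k ^ p := by
    have : k ^ p = k ^ (p - 1) * k := by
      rw [← Real.rpow_add_one' hk.le (by linarith), sub_add_cancel]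
    rw [this, hkdef]
    field_simp
  have hkpos : 0 < k ^ (p - 1) := by positivity
  have h1 := mul_le_mul_of_nonneg_left (add_le_add hpos hneg) hkpos.le
  rw [← mul_add, ← hsplit, ← mul_assoc, hkk, ← sub_eq_add_neg] at h1
  linarith

end Hardy

section ConvexDomain

variable {E : Type*} [NormedAddCommGroup E] [InnerProductSpace ℝ E] [FiniteDimensional ℝ E]
  [MeasurableSpace E] [BorelSpace E] {μ : Measure E} [μ.IsAddHaarMeasure]

/-- The geometric `L^p` Hardy inequality along an affine field in an open convex set. -/
lemma hardy_affField {ℓ : E →L[ℝ] ℝ} {a b : E} (ha : ℓ a = 0) (hb : ℓ b = 0)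
    {p : ℝ} (hp : 2 ≤ p) {Ω : Set E} (hΩ : IsOpen Ω) (hconv : Convex ℝ Ω)
    {ν : E → E} (hν : ∀ x ∈ Ω, ‖ν x‖ = 1)
    (hνnear : ∀ x ∈ Ω, x + infDist x (frontier Ω) • ν x ∈ frontier Ω)
    {u : E → ℝ} (hu : ContDiff ℝ 1 u) (huc : HasCompactSupport u) (huΩ : tsupport u ⊆ Ω) :
    IntegrableOn (fun x => |inner ℝ (ν x) (affField ℓ a b x)| ^ p / infDist x (frontier Ω) ^ p *
        |u x| ^ p) Ω μ ∧
      ((p - 1) / p) ^ p * ∫ x in Ω, |inner ℝ (ν x) (affField ℓ a b x)| ^ p /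
          infDist x (frontier Ω) ^ p * |u x| ^ p ∂μ ≤
        ∫ x in Ω, |fderiv ℝ u x (affField ℓ a b x)| ^ p ∂μ := by
  have hp0 : 0 < p := by linarith
  set d : E → ℝ := fun x => infDist x (frontier Ω) with hd
  set M : E → ℝ := Ω.indicator fun x => -inner ℝ (ν x) (affField ℓ a b x) with hM
  have hMΩ : ∀ x ∈ Ω, M x = -inner ℝ (ν x) (affField ℓ a b x) := fun x hx =>
    indicator_of_mem hx _
  have hMm : AEMeasurable M μ := by
    have hmeas : Measurable (Ω.indicator fun x => fderiv ℝ d x a + ℓ x * fderiv ℝ d x b) :=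
      (((measurable_fderiv_apply_const ℝ d a).add
        (ℓ.measurable.mul (measurable_fderiv_apply_const ℝ d b)))).indicator hΩ.measurableSet
    refine ⟨_, hmeas, ?_⟩
    filter_upwards [(lipschitz_infDist_pt (frontier Ω)).ae_differentiableAt (μ := μ)] with x hx
    by_cases hxΩ : x ∈ Ω
    · have h := fderiv_infDist_frontier_of_differentiableAt hΩ hconv hxΩ (hν x hxΩ)
        (hνnear x hxΩ) hx
      rw [hMΩ x hxΩ, indicator_of_mem hxΩ, h, h, affField, inner_add_right, inner_smul_right]
      ring
    · rw [hM, indicator_of_notMem hxΩ, indicator_of_notMem hxΩ]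
  have hmain := hardy_affFlow ha hb hp hΩ (d := d) (M := M) (μ := μ)
    (continuous_infDist_pt _) (fun x hx => infDist_frontier_pos hΩ ⟨_, hνnear x hx⟩ hx) hMm
    (fun x hx => by
      rw [hMΩ x hx, abs_neg]
      simpa [hν x hx] using abs_real_inner_le_norm (ν x) (affField ℓ a b x))
    (fun x hx h hxh => by
      refine (infDist_frontier_le_sub_inner hΩ hconv hx hxh (hν x hx) (hνnear x hx)).trans_eq ?_
      rw [hMΩ x hx, affFlow, add_sub_cancel_left, inner_smul_right]
      ring) hu huc huΩ
  have heq : ∀ x ∈ Ω, |M x| ^ p / d x ^ p * |u x| ^ p =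
      |inner ℝ (ν x) (affField ℓ a b x)| ^ p / infDist x (frontier Ω) ^ p * |u x| ^ p :=
    fun x hx => by rw [hMΩ x hx, abs_neg]
  refine ⟨hmain.1.integrableOn.congr_fun heq hΩ.measurableSet, ?_⟩
  have hout : ∀ x, x ∉ Ω → x ∉ tsupport u := fun x hx h => hx (huΩ h)
  rw [← setIntegral_congr_fun hΩ.measurableSet heq,
    setIntegral_eq_integral_of_forall_compl_eq_zero fun x hx => by
      rw [image_eq_zero_of_notMem_tsupport (hout x hx), abs_zero, Real.zero_rpow hp0.ne', mul_zero],
    setIntegral_eq_integral_of_forall_compl_eq_zero fun x hx => by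
      rw [fderiv_of_notMem_tsupport ℝ (hout x hx)]
      simp [hp0.ne']]
  exact hmain.2

end ConvexDomain

section Heisenberg

variable {n : ℕ}

lemma xIdx_ne_yIdx (i j : Fin n) : xIdx i ≠ yIdx j := fun h => by
  have := congrArg Fin.val h
  simp only [xIdx, yIdx] at this
  omega

lemma xIdx_ne_tIdx (i : Fin n) : xIdx i ≠ tIdx n := fun h => by
  have := congrArg Fin.val h
  simp only [xIdx, tIdx] at this
  omega

lemma yIdx_ne_tIdx (i : Fin n) : yIdx i ≠ tIdx n := fun h => by
  have := congrArg Fin.val h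
  simp only [yIdx, tIdx] at this
  omega

/-- The vector field `X_i` as an affine field. -/
def XField (i : Fin n) : Heis n → Heis n :=
  affField ((2 : ℝ) • EuclideanSpace.proj (𝕜 := ℝ) (yIdx i)) (EuclideanSpace.single (xIdx i) 1)
    (EuclideanSpace.single (tIdx n) 1)

/-- The vector field `Y_i` as an affine field. -/
def YField (i : Fin n) : Heis n → Heis n :=
  affField ((-2 : ℝ) • EuclideanSpace.proj (𝕜 := ℝ) (xIdx i)) (EuclideanSpace.single (yIdx i) 1)
    (EuclideanSpace.single (tIdx n) 1)

lemma fderiv_XField (i : Fin n) (u : Heis n → ℝ) (ξ : Heis n) :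
    fderiv ℝ u ξ (XField i ξ) = Xd i u ξ := by
  simp [XField, affField, Xd]

lemma fderiv_YField (i : Fin n) (u : Heis n → ℝ) (ξ : Heis n) :
    fderiv ℝ u ξ (YField i ξ) = Yd i u ξ := by
  simp [YField, affField, Yd, sub_eq_add_neg]

lemma inner_XField (i : Fin n) (ξ ν : Heis n) : inner ℝ ν (XField i ξ) = XiNu i ξ ν := by
  simp [XField, affField, XiNu, inner_add_right, inner_smul_right,
    EuclideanSpace.inner_single_right]

lemma inner_YField (i : Fin n) (ξ ν : Heis n) : inner ℝ ν (YField i ξ) = YiNu i ξ ν := by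
  simp [YField, affField, YiNu, inner_add_right, inner_smul_right,
    EuclideanSpace.inner_single_right, sub_eq_add_neg]

lemma continuous_Xd {u : Heis n → ℝ} (hu : ContDiff ℝ 1 u) (i : Fin n) : Continuous (Xd i u) := by
  have h := (hu.continuous_fderiv one_ne_zero).clm_apply
    (continuous_affField : Continuous (XField i))
  exact h.congr fun ξ => fderiv_XField i u ξ

lemma continuous_Yd {u : Heis n → ℝ} (hu : ContDiff ℝ 1 u) (i : Fin n) : Continuous (Yd i u) := by
  have h := (hu.continuous_fderiv one_ne_zero).clm_apply
    (continuous_affField : Continuous (YField i))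
  exact h.congr fun ξ => fderiv_YField i u ξ

end Heisenberg

/-- Theorem 4 of the paper: the geometric `L^p` Hardy inequality, `p ≥ 2`,
on an open convex domain `Ω ⊆ ℍⁿ`. For `ξ ∈ Ω`, `ν ξ` is a unit vector such that
`ξ̂ = ξ + dist(ξ, ∂Ω) • ν ξ ∈ ∂Ω` realizes the Euclidean distance from `ξ` to `∂Ω`. -/
theorem hardy_convex_Lp (n : ℕ) (hn : 1 ≤ n) (p : ℝ) (hp : 2 ≤ p) (Ω : Set (Heis n))
    (hopen : IsOpen Ω) (hconv : Convex ℝ Ω)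
    (ν : Heis n → Heis n) (hν1 : ∀ ξ ∈ Ω, ‖ν ξ‖ = 1)
    (hνnear : ∀ ξ ∈ Ω, ξ + Metric.infDist ξ (frontier Ω) • ν ξ ∈ frontier Ω)
    (u : Heis n → ℝ) (hu : ContDiff ℝ (⊤ : ℕ∞) u) (hc : HasCompactSupport u)
    (hsupp : tsupport u ⊆ Ω) :
    ∫ ξ in Ω, Real.sqrt (gradH2 u ξ) ^ p ≥
      ((p - 1) / p) ^ p * ∫ ξ in Ω,
        (∑ i : Fin n, (|XiNu i ξ (ν ξ)| ^ p + |YiNu i ξ (ν ξ)| ^ p))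
          / (Metric.infDist ξ (frontier Ω)) ^ p * |u ξ| ^ p := by
  have hp0 : 0 < p := by linarith
  have hu1 : ContDiff ℝ 1 u := hu.of_le (by exact_mod_cast le_top)
  have hX := fun i : Fin n => hardy_affField (μ := volume)
    (ℓ := (2 : ℝ) • EuclideanSpace.proj (𝕜 := ℝ) (yIdx i))
    (a := EuclideanSpace.single (xIdx i) 1) (b := EuclideanSpace.single (tIdx n) 1)
    (by simp [(xIdx_ne_yIdx i i).symm]) (by simp [yIdx_ne_tIdx i]) hp hopen hconv hν1 hνnear
    hu1 hc hsupp
  have hY := fun i : Fin n => hardy_affField (μ := volume)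
    (ℓ := (-2 : ℝ) • EuclideanSpace.proj (𝕜 := ℝ) (xIdx i))
    (a := EuclideanSpace.single (yIdx i) 1) (b := EuclideanSpace.single (tIdx n) 1)
    (by simp [xIdx_ne_yIdx i i]) (by simp [xIdx_ne_tIdx i]) hp hopen hconv hν1 hνnear
    hu1 hc hsupp
  simp only [← XField.eq_1, fderiv_XField, inner_XField] at hX
  simp only [← YField.eq_1, fderiv_YField, inner_YField] at hY
  have hXi : ∀ i : Fin n, IntegrableOn (fun ξ => |Xd i u ξ| ^ p) Ω := fun i => by
    have h := integrable_abs_fderiv_apply_rpow (μ := volume) hp0 hu1 hc (w := XField i)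
      continuous_affField
    simp only [fderiv_XField] at h
    exact h.integrableOn
  have hYi : ∀ i : Fin n, IntegrableOn (fun ξ => |Yd i u ξ| ^ p) Ω := fun i => by
    have h := integrable_abs_fderiv_apply_rpow (μ := volume) hp0 hu1 hc (w := YField i)
      continuous_affField
    simp only [fderiv_YField] at h
    exact h.integrableOn
  have hgrad : IntegrableOn (fun ξ => Real.sqrt (gradH2 u ξ) ^ p) Ω := by
    have hgc : Continuous fun ξ => Real.sqrt (gradH2 u ξ) ^ p := by
      refine (Real.continuous_sqrt.comp ?_).rpow_const fun _ => .inr hp0.le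
      exact continuous_finsetSum _ fun i _ => ((continuous_Xd hu1 i).pow 2).add ((continuous_Yd hu1 i).pow 2)
    refine (hgc.integrable_of_hasCompactSupport (hc.mono' fun ξ hξ => ?_)).integrableOn
    by_contra h
    refine hξ ?_
    simp [gradH2, Xd, Yd, fderiv_of_notMem_tsupport (𝕜 := ℝ) h, hp0.ne']
  have hrhs : ∫ ξ in Ω, (∑ i : Fin n, (|XiNu i ξ (ν ξ)| ^ p + |YiNu i ξ (ν ξ)| ^ p))
          / (infDist ξ (frontier Ω)) ^ p * |u ξ| ^ p =
      ∑ i : Fin n, ((∫ ξ in Ω, |XiNu i ξ (ν ξ)| ^ p / infDist ξ (frontier Ω) ^ p * |u ξ| ^ p) +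
        ∫ ξ in Ω, |YiNu i ξ (ν ξ)| ^ p / infDist ξ (frontier Ω) ^ p * |u ξ| ^ p) := by
    simp_rw [← integral_add (hX _).1 (hY _).1]
    refine Eq.trans ?_ (integral_finsetSum _ fun i _ => (hX i).1.add (hY i).1)
    congr 1 with ξ
    rw [Finset.sum_div, Finset.sum_mul]
    exact Finset.sum_congr rfl fun i _ => by ring
  rw [ge_iff_le, hrhs, Finset.mul_sum]
  calc ∑ i : Fin n, ((p - 1) / p) ^ p *
        ((∫ ξ in Ω, |XiNu i ξ (ν ξ)| ^ p / infDist ξ (frontier Ω) ^ p * |u ξ| ^ p) +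
          ∫ ξ in Ω, |YiNu i ξ (ν ξ)| ^ p / infDist ξ (frontier Ω) ^ p * |u ξ| ^ p)
      ≤ ∑ i : Fin n, ((∫ ξ in Ω, |Xd i u ξ| ^ p) + ∫ ξ in Ω, |Yd i u ξ| ^ p) :=
        Finset.sum_le_sum fun i _ => by
          rw [mul_add]
          exact add_le_add (hX i).2 (hY i).2
    _ = ∫ ξ in Ω, ∑ i : Fin n, (|Xd i u ξ| ^ p + |Yd i u ξ| ^ p) := by
        simp_rw [← integral_add (hXi _) (hYi _)]
        exact (integral_finsetSum _ fun i _ => (hXi i).add (hYi i)).symm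
    _ ≤ ∫ ξ in Ω, Real.sqrt (gradH2 u ξ) ^ p :=
        integral_mono (integrable_finsetSum _ fun i _ => (hXi i).add (hYi i)) hgrad fun ξ =>
          sum_abs_rpow_le_sqrt_rpow Finset.univ hp _ _
end
end
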